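/- If C is a free E-linear code of length n, then its left hull LHull(C) and its hull Hull(C) are both free E-linear codes, and moreover LHull(C) = Hull(C). -/

import Mathlib

open scoped BigOperators

/-- The non-unital ring `E` of order 4: the pair `(u, v)` represents `uκ + vζ`,
where `ζ = κ + τ`.  Multiplication: `(uκ + vζ)·(u'κ + v'ζ) = u'·(uκ + vζ)`. -/
def RingE : Type := ZMod 2 × ZMod 2

namespace RingE

instance : AddCommGroup RingE := inferInstanceAs (AddCommGroup (ZMod 2 × ZMod 2))

instance : Mul RingE := ⟨fun a b => Prod.mk (Prod.fst a * Prod.fst b) (Prod.snd a * Prod.fst b)⟩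

noncomputable instance : DecidableEq RingE := Classical.decEq _

instance : NonUnitalRing RingE where
  left_distrib a b c := by
    show Prod.mk (Prod.fst a * (Prod.fst b + Prod.fst c))
        (Prod.snd a * (Prod.fst b + Prod.fst c)) = _
    show _ = Prod.mk (Prod.fst a * Prod.fst b + Prod.fst a * Prod.fst c)
        (Prod.snd a * Prod.fst b + Prod.snd a * Prod.fst c)
    simp [mul_add]
  right_distrib a b c := by
    show Prod.mk ((Prod.fst a + Prod.fst b) * Prod.fst c)
        ((Prod.snd a + Prod.snd b) * Prod.fst c) = _
    show _ = Prod.mk (Prod.fst a * Prod.fst c + Prod.fst b * Prod.fst c)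
        (Prod.snd a * Prod.fst c + Prod.snd b * Prod.fst c)
    simp [add_mul]
  zero_mul a := by
    show Prod.mk ((0 : ZMod 2) * Prod.fst a) ((0 : ZMod 2) * Prod.fst a) = ((0 : ZMod 2), (0 : ZMod 2))
    simp
  mul_zero a := by
    show Prod.mk (Prod.fst a * (0 : ZMod 2)) (Prod.snd a * (0 : ZMod 2)) = ((0 : ZMod 2), (0 : ZMod 2))
    simp
  mul_assoc a b c := by
    show Prod.mk (Prod.fst a * Prod.fst b * Prod.fst c) (Prod.snd a * Prod.fst b * Prod.fst c)
      = Prod.mk (Prod.fst a * (Prod.fst b * Prod.fst c)) (Prod.snd a * (Prod.fst b * Prod.fst c))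
    simp [mul_assoc]

/-- The generator `κ`. -/
def kappa : RingE := Prod.mk 1 0

/-- The generator `τ`. -/
def tau : RingE := Prod.mk 1 1

/-- `ζ = κ + τ`. -/
def zeta : RingE := Prod.mk 0 1

/-- The reduction map `π : E → F₂`, sending `uκ + vζ` to `u`. -/
def pi (a : RingE) : ZMod 2 := Prod.fst a

/-- `κ·c` for a scalar `c ∈ F₂`, i.e. the element `cκ` of `E`. -/
def kappaSMul (c : ZMod 2) : RingE := Prod.mk c 0

/-- `ζ·c` for a scalar `c ∈ F₂`, i.e. the element `cζ` of `E`. -/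
def zetaSMul (c : ZMod 2) : RingE := Prod.mk 0 c

end RingE

namespace ECode

/-- Componentwise reduction `π : Eⁿ → F₂ⁿ`. -/
def piVec {n : ℕ} (x : Fin n → RingE) : Fin n → ZMod 2 := fun i => RingE.pi (x i)

/-- The vector `κv ∈ Eⁿ` attached to `v ∈ F₂ⁿ`. -/
def kappaVec {n : ℕ} (v : Fin n → ZMod 2) : Fin n → RingE := fun i => RingE.kappaSMul (v i)

/-- The vector `ζv ∈ Eⁿ` attached to `v ∈ F₂ⁿ`. -/
def zetaVec {n : ℕ} (v : Fin n → ZMod 2) : Fin n → RingE := fun i => RingE.zetaSMul (v i)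

/-- An `E`-linear code of length `n`: a left `E`-submodule of `Eⁿ`, i.e. an additive
subgroup closed under componentwise left multiplication by elements of `E`. -/
def IsECode {n : ℕ} (C : Set (Fin n → RingE)) : Prop :=
  (0 : Fin n → RingE) ∈ C ∧ (∀ x ∈ C, ∀ y ∈ C, x + y ∈ C) ∧ (∀ x ∈ C, -x ∈ C) ∧
    ∀ (a : RingE), ∀ x ∈ C, (fun i => a * x i) ∈ C

/-- The residue code `C_Res = π(C)`. -/
def Res {n : ℕ} (C : Set (Fin n → RingE)) : Set (Fin n → ZMod 2) := piVec '' C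

/-- The torsion code `C_Tor = {v ∈ F₂ⁿ : ζv ∈ C}`. -/
def Tor {n : ℕ} (C : Set (Fin n → RingE)) : Set (Fin n → ZMod 2) := {v | zetaVec v ∈ C}

/-- A code is free if its residue and torsion codes coincide. -/
def IsFree {n : ℕ} (C : Set (Fin n → RingE)) : Prop := Res C = Tor C

/-- The inner product on `Eⁿ`. -/
def Einner {n : ℕ} (w z : Fin n → RingE) : RingE := ∑ i, w i * z i

/-- The left dual `C^{⊥L}`. -/
def dualL {n : ℕ} (C : Set (Fin n → RingE)) : Set (Fin n → RingE) :=
  {z | ∀ w ∈ C, Einner z w = 0}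

/-- The right dual `C^{⊥R}`. -/
def dualR {n : ℕ} (C : Set (Fin n → RingE)) : Set (Fin n → RingE) :=
  {z | ∀ w ∈ C, Einner w z = 0}

/-- The (two-sided) dual `C^⊥ = C^{⊥L} ∩ C^{⊥R}`. -/
def dualE {n : ℕ} (C : Set (Fin n → RingE)) : Set (Fin n → RingE) := dualL C ∩ dualR C

/-- The left hull `LHull(C) = C ∩ C^{⊥L}`. -/
def LHull {n : ℕ} (C : Set (Fin n → RingE)) : Set (Fin n → RingE) := C ∩ dualL C

/-- The right hull `RHull(C) = C ∩ C^{⊥R}`. -/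
def RHull {n : ℕ} (C : Set (Fin n → RingE)) : Set (Fin n → RingE) := C ∩ dualR C

/-- The hull `Hull(C) = C ∩ C^⊥`. -/
def EHull {n : ℕ} (C : Set (Fin n → RingE)) : Set (Fin n → RingE) := C ∩ dualE C

/-- The Euclidean inner product on `F₂ⁿ`. -/
def Finner {n : ℕ} (w z : Fin n → ZMod 2) : ZMod 2 := ∑ i, w i * z i

/-- The Euclidean dual of an `F₂`-linear code. -/
def dualF {n : ℕ} (B : Set (Fin n → ZMod 2)) : Set (Fin n → ZMod 2) :=
  {z | ∀ w ∈ B, Finner w z = 0}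

/-- The hull of an `F₂`-linear code. -/
def FHull {n : ℕ} (B : Set (Fin n → ZMod 2)) : Set (Fin n → ZMod 2) := B ∩ dualF B

/-- `F₂`-dimension of an `F₂`-linear code (as the dimension of its span). -/
noncomputable def dimF {n : ℕ} (B : Set (Fin n → ZMod 2)) : ℕ :=
  Module.finrank (ZMod 2) (Submodule.span (ZMod 2) B)

/-- Scalar multiplication of a vector of `Eⁿ` by `a ∈ E`. -/
def smulVec {n : ℕ} (a : RingE) (x : Fin n → RingE) : Fin n → RingE := fun i => a * x i

/-- The left `E`-span `⟨X⟩_E` of a finite set `X ⊆ Eⁿ`. -/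
def spanE {n : ℕ} (X : Finset (Fin n → RingE)) : Set (Fin n → RingE) :=
  {y | ∃ c : (Fin n → RingE) → RingE, y = ∑ x ∈ X, smulVec (c x) x}

/-- The additive (`F₂`-) span `⟨X⟩_{F₂}` of a finite set `X ⊆ Eⁿ`: all sums of subsets. -/
def spanF {n : ℕ} (X : Finset (Fin n → RingE)) : Set (Fin n → RingE) :=
  {y | ∃ S : Finset (Fin n → RingE), S ⊆ X ∧ y = ∑ x ∈ S, x}

/-- `X` is a generating set of the code `D` if `⟨X⟩_E ∪ ⟨X⟩_{F₂} = D`. -/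
def IsGenSet {n : ℕ} (X : Finset (Fin n → RingE)) (D : Set (Fin n → RingE)) : Prop :=
  spanE X ∪ spanF X = D

/-- The rank of a (free) code: the minimum cardinality of a generating set. -/
noncomputable def genRank {n : ℕ} (D : Set (Fin n → RingE)) : ℕ :=
  sInf {m | ∃ X : Finset (Fin n → RingE), X.card = m ∧ IsGenSet X D}

/-- Prepending two coordinates to a vector of length `n`. -/
def cons2 {n : ℕ} (a b : RingE) (x : Fin n → RingE) : Fin (n + 2) → RingE :=
  Fin.cons a (Fin.cons b x)

end ECode

namespace ECode

theorem fst_sum' {n : ℕ} (f : Fin n → RingE) :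
    Prod.fst (∑ i, f i : RingE) = ∑ i, Prod.fst (f i) :=
  map_sum (AddMonoidHom.fst (ZMod 2) (ZMod 2)) f Finset.univ

theorem snd_sum' {n : ℕ} (f : Fin n → RingE) :
    Prod.snd (∑ i, f i : RingE) = ∑ i, Prod.snd (f i) :=
  map_sum (AddMonoidHom.snd (ZMod 2) (ZMod 2)) f Finset.univ

/-- Second coordinates. -/
def sndVec {n : ℕ} (x : Fin n → RingE) : Fin n → ZMod 2 := fun i => Prod.snd (x i)

theorem Einner_zero_iff {n : ℕ} (w z : Fin n → RingE) :
    Einner w z = 0 ↔ Finner (piVec w) (piVec z) = 0 ∧ Finner (sndVec w) (piVec z) = 0 := by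
  have h1 : Prod.fst (Einner w z) = Finner (piVec w) (piVec z) := fst_sum' _
  have h2 : Prod.snd (Einner w z) = Finner (sndVec w) (piVec z) := snd_sum' _
  rw [← h1, ← h2]
  exact Prod.ext_iff

theorem Finner_comm {n : ℕ} (w z : Fin n → ZMod 2) : Finner w z = Finner z w := by
  simp [Finner, mul_comm]

theorem zeta_mul_vec {n : ℕ} (x : Fin n → RingE) :
    (fun i => RingE.zeta * x i) = zetaVec (piVec x) := by
  funext i
  show Prod.mk ((0 : ZMod 2) * Prod.fst (x i)) ((1 : ZMod 2) * Prod.fst (x i))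
    = Prod.mk (0 : ZMod 2) (Prod.fst (x i))
  simp

theorem kappa_mul_vec {n : ℕ} (x : Fin n → RingE) :
    (fun i => RingE.kappa * x i) = kappaVec (piVec x) := by
  funext i
  show Prod.mk ((1 : ZMod 2) * Prod.fst (x i)) ((0 : ZMod 2) * Prod.fst (x i))
    = Prod.mk (Prod.fst (x i)) (0 : ZMod 2)
  simp

theorem eq_add_vec {n : ℕ} (x : Fin n → RingE) :
    zetaVec (sndVec x) = x + -kappaVec (piVec x) := by
  funext i
  show Prod.mk (0 : ZMod 2) (Prod.snd (x i))
    = Prod.mk (Prod.fst (x i) + - Prod.fst (x i)) (Prod.snd (x i) + -(0 : ZMod 2))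
  rw [add_neg_cancel, neg_zero, add_zero]

theorem LHull_isECode {n : ℕ} {C : Set (Fin n → RingE)} (hC : IsECode C) :
    IsECode (LHull C) := by
  obtain ⟨h0, ha, hn, hm⟩ := hC
  refine ⟨⟨h0, fun w _ => ?_⟩, fun x hx y hy => ⟨ha x hx.1 y hy.1, fun w hw => ?_⟩,
    fun x hx => ⟨hn x hx.1, fun w hw => ?_⟩, fun a x hx => ⟨hm a x hx.1, fun w hw => ?_⟩⟩
  · simp [Einner]
  · have h1 := hx.2 w hw
    have h2 := hy.2 w hw
    simp only [Einner] at h1 h2 ⊢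
    simp [add_mul, Finset.sum_add_distrib, h1, h2]
  · have h1 := hx.2 w hw
    simp only [Einner] at h1 ⊢
    simp [h1]
  · have h1 := hx.2 w hw
    simp only [Einner] at h1 ⊢
    simp only [mul_assoc, ← Finset.mul_sum, h1, mul_zero]

theorem LHull_isFree {n : ℕ} {C : Set (Fin n → RingE)} (hC : IsECode C) (hfree : IsFree C) :
    IsFree (LHull C) := by
  have hL := LHull_isECode hC
  apply Set.Subset.antisymm
  · rintro _ ⟨x, hx, rfl⟩
    show zetaVec (piVec x) ∈ LHull C
    rw [← zeta_mul_vec]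
    exact hL.2.2.2 _ x hx
  · intro v hv
    have hv' : zetaVec v ∈ LHull C := hv
    have hvC : v ∈ Res C := by
      rw [hfree]
      exact hv'.1
    obtain ⟨x, hx, rfl⟩ := hvC
    refine ⟨kappaVec (piVec x), ⟨?_, fun w hw => ?_⟩, rfl⟩
    · rw [← kappa_mul_vec]
      exact hC.2.2.2 _ x hx
    · have h := ((Einner_zero_iff _ _).1 (hv'.2 w hw)).2
      refine (Einner_zero_iff _ _).2 ⟨h, ?_⟩
      exact Finset.sum_eq_zero fun i _ => zero_mul _

theorem LHull_eq_EHull {n : ℕ} {C : Set (Fin n → RingE)} (hC : IsECode C) (hfree : IsFree C) :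
    LHull C = EHull C := by
  apply Set.Subset.antisymm
  · intro z hz
    refine ⟨hz.1, hz.2, fun w hw => ?_⟩
    have hs : sndVec w ∈ Res C := by
      rw [hfree]
      show zetaVec (sndVec w) ∈ C
      rw [eq_add_vec, ← kappa_mul_vec]
      exact hC.2.1 _ hw _ (hC.2.2.1 _ (hC.2.2.2 _ w hw))
    obtain ⟨y, hy, hyw⟩ := hs
    refine (Einner_zero_iff _ _).2 ⟨?_, ?_⟩
    · rw [Finner_comm]
      exact ((Einner_zero_iff _ _).1 (hz.2 w hw)).1
    · rw [← hyw, Finner_comm]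
      exact ((Einner_zero_iff _ _).1 (hz.2 y hy)).1
  · exact fun z hz => ⟨hz.1, hz.2.1⟩

end ECode

open ECode in
/-- If `C` is free, then `LHull(C)` and `Hull(C)` are free `E`-linear
codes, and `LHull(C) = Hull(C)`. -/
theorem LHull_Hull_free_and_eq {n : ℕ} (C : Set (Fin n → RingE)) (hC : IsECode C)
    (hfree : IsFree C) :
    IsECode (LHull C) ∧ IsFree (LHull C) ∧ IsECode (EHull C) ∧ IsFree (EHull C) ∧
      LHull C = EHull C := by
  have h := LHull_eq_EHull hC hfree
  rw [← h]
  exact ⟨LHull_isECode hC, LHull_isFree hC hfree, LHull_isECode hC, LHull_isFree hC hfree, rfl⟩
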